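/- arXiv:1401.7896 — 2 statements merged into one kernel-verified Lean document; each statement's English description precedes it below -/
import Mathlib

section
/- Let n ≥ 1, let F be a Banach space containing no copy of c₀, and let T : c₀ × ⋯ × c₀ → F be a continuous n-linear map. Let (k_j)_{j∈ℕ} be a strictly increasing sequence of natural numbers and, for each 1 ≤ i ≤ n, let (v_j^i)_{j∈ℕ} be a sequence in c₀ such that v_j^i is supported on the coordinates {k_j + 1, …, k_{j+1}} and ‖v_j^i‖ = 1. Then the series Σ_{j∈ℕ} T(v_j^1,…,v_j^n) converges unconditionally in F; in particular, ‖T(v_j^1,…,v_j^n)‖ → 0 as j → ∞. -/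
open Filter Topology

noncomputable section

namespace GV

/-- A Banach space `F` contains a copy of `c₀` if there is a continuous linear map
`ι : c₀ → F` which is an isomorphism onto its range, i.e. there are constants `0 < c ≤ C`
with `c‖x‖ ≤ ‖ι x‖ ≤ C‖x‖` for all `x ∈ c₀`. -/
def ContainsCopyOfC0 (𝕜 F : Type*) [RCLike 𝕜] [NormedAddCommGroup F] [NormedSpace 𝕜 F] : Prop :=
  ∃ (ι : ZeroAtInftyContinuousMap ℕ 𝕜 →L[𝕜] F) (c C : ℝ), 0 < c ∧ c ≤ C ∧
    ∀ x : ZeroAtInftyContinuousMap ℕ 𝕜, c * ‖x‖ ≤ ‖ι x‖ ∧ ‖ι x‖ ≤ C * ‖x‖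

theorem norm_apply_le {𝕜 : Type*} [RCLike 𝕜] (x : ZeroAtInftyContinuousMap ℕ 𝕜) (m : ℕ) :
    ‖x m‖ ≤ ‖x‖ := by
  rw [← ZeroAtInftyContinuousMap.norm_toBCF_eq_norm]
  exact x.toBCF.norm_coe_le_norm m

theorem norm_le_of_forall_apply_le {𝕜 : Type*} [RCLike 𝕜] {x : ZeroAtInftyContinuousMap ℕ 𝕜}
    {r : ℝ} (hr : 0 ≤ r) (h : ∀ m, ‖x m‖ ≤ r) : ‖x‖ ≤ r := by
  rw [← ZeroAtInftyContinuousMap.norm_toBCF_eq_norm]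
  exact (BoundedContinuousFunction.norm_le hr).2 h

/-- **Rosenthal's lemma**: a nonnegative matrix with bounded row sums has an infinite principal
submatrix whose off-diagonal row sums are at most `δ`. -/
theorem exists_injective_offDiag_sum_le {δ : ℝ} (hδ : 0 ≤ δ) (N : ℕ) (a : ℕ → ℕ → ℝ)
    (ha : ∀ m k, 0 ≤ a m k) (hrow : ∀ m (s : Finset ℕ), ∑ k ∈ s, a m k ≤ N * δ) :
    ∃ φ : ℕ → ℕ, Function.Injective φ ∧
      ∀ m (s : Finset ℕ), m ∉ s → ∑ k ∈ s, a (φ m) (φ k) ≤ δ := by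
  induction N generalizing a with
  | zero =>
    refine ⟨id, Function.injective_id, fun m s _ => (hrow m s).trans ?_⟩
    simpa using hδ
  | succ N ih =>
    by_cases hp : ∃ p, ∀ m (s : Finset ℕ), m ∉ s →
        ∑ k ∈ s, a (Nat.pair p m) (Nat.pair p k) ≤ δ
    · obtain ⟨p, hp⟩ := hp
      exact ⟨Nat.pair p, fun i j h => (Nat.pair_eq_pair.1 h).2, hp⟩
    · push Not at hp
      choose m s hms hs using hp
      have hinj : Function.Injective fun p => Nat.pair p (m p) :=
        fun i j h => (Nat.pair_eq_pair.1 h).1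
      obtain ⟨φ, hφ, h⟩ := ih (fun p q => a (Nat.pair p (m p)) (Nat.pair q (m q)))
        (fun _ _ => ha _ _) (fun p t => by
          have hdisj : Disjoint (t.image fun q => Nat.pair q (m q))
              ((s p).image (Nat.pair p)) := by
            simp only [Finset.disjoint_left, Finset.mem_image]
            rintro _ ⟨q, -, rfl⟩ ⟨k, hk, hkq⟩
            obtain ⟨rfl, rfl⟩ := Nat.pair_eq_pair.1 hkq
            exact hms _ hk
          have h1 := hrow (Nat.pair p (m p)) (t.image (fun q => Nat.pair q (m q)) ∪
            (s p).image (Nat.pair p))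
          rw [Finset.sum_union hdisj, Finset.sum_image hinj.injOn,
            Finset.sum_image fun i _ j _ h => (Nat.pair_eq_pair.1 h).2] at h1
          have h2 := hs p
          push_cast at h1
          linarith)
      exact ⟨fun p => Nat.pair (φ p) (m (φ p)), hinj.comp hφ, h⟩

section BoundedSeries

variable {𝕜 F : Type*} [RCLike 𝕜] [NormedAddCommGroup F] [NormedSpace 𝕜 F]

theorem norm_sum_smul_le_mul {y : ℕ → F} {C : ℝ}
    (hC : ∀ (s : Finset ℕ) (a : ℕ → 𝕜), (∀ j ∈ s, ‖a j‖ ≤ 1) → ‖∑ j ∈ s, a j • y j‖ ≤ C)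
    (s : Finset ℕ) (a : ℕ → 𝕜) {r : ℝ} (hr : 0 < r) (ha : ∀ j ∈ s, ‖a j‖ ≤ r) :
    ‖∑ j ∈ s, a j • y j‖ ≤ C * r := by
  have hr' : (r : 𝕜) ≠ 0 := by exact_mod_cast hr.ne'
  have h := hC s (fun j => (r : 𝕜)⁻¹ * a j) fun j hj => by
    rw [norm_mul, norm_inv, RCLike.norm_ofReal, abs_of_pos hr, inv_mul_le_iff₀ hr, mul_one]
    exact ha j hj
  simp_rw [mul_smul] at h
  rwa [← Finset.smul_sum, norm_smul, norm_inv, RCLike.norm_ofReal, abs_of_pos hr,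
    inv_mul_le_iff₀ hr, mul_comm] at h

theorem sum_norm_apply_le {y : ℕ → F} {C : ℝ}
    (hC : ∀ (s : Finset ℕ) (a : ℕ → 𝕜), (∀ j ∈ s, ‖a j‖ ≤ 1) → ‖∑ j ∈ s, a j • y j‖ ≤ C)
    {f : F →L[𝕜] 𝕜} (hf : ‖f‖ ≤ 1) (s : Finset ℕ) : ∑ k ∈ s, ‖f (y k)‖ ≤ C := by
  have hrot : ∀ z : 𝕜, ∃ c : 𝕜, ‖c‖ ≤ 1 ∧ c * z = (‖z‖ : 𝕜) := fun z => by
    rcases eq_or_ne z 0 with rfl | hz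
    · exact ⟨0, by simp, by simp⟩
    · have hz' : (‖z‖ : 𝕜) ≠ 0 := by exact_mod_cast norm_ne_zero_iff.2 hz
      refine ⟨(‖z‖ : 𝕜)⁻¹ * (starRingEnd 𝕜) z, ?_, ?_⟩
      · simp [norm_ne_zero_iff.2 hz]
      · rw [mul_assoc, RCLike.conj_mul, pow_two, inv_mul_cancel_left₀ hz']
  choose c hc hcz using hrot
  have h1 : f (∑ k ∈ s, c (f (y k)) • y k) = ((∑ k ∈ s, ‖f (y k)‖ : ℝ) : 𝕜) := by
    simp [hcz]
  have h2 := f.le_of_opNorm_le hf (∑ k ∈ s, c (f (y k)) • y k)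
  rw [h1, RCLike.norm_ofReal, one_mul] at h2
  exact (le_abs_self _).trans (h2.trans (hC s _ fun _ _ => hc _))

theorem summable_smul_of_zeroAtInfty [CompleteSpace F] {y : ℕ → F} {C : ℝ}
    (hC : ∀ (s : Finset ℕ) (a : ℕ → 𝕜), (∀ j ∈ s, ‖a j‖ ≤ 1) → ‖∑ j ∈ s, a j • y j‖ ≤ C)
    (x : ZeroAtInftyContinuousMap ℕ 𝕜) : Summable fun j => x j • y j := by
  have hC0 : 0 ≤ C := by simpa using hC ∅ 0
  rw [summable_iff_vanishing_norm]
  intro ε hε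
  have hpos : 0 < ε / (C + 1) := by positivity
  have hx : ∀ᶠ j in cofinite, ‖x j‖ < ε / (C + 1) := by
    have h := x.zero_at_infty'
    rw [cocompact_eq_cofinite] at h
    simpa using h.norm.eventually_lt_const (by simpa using hpos)
  refine ⟨(eventually_cofinite.1 hx).toFinset, fun t ht => ?_⟩
  have h := norm_sum_smul_le_mul hC t x hpos fun j hj => by
    have := Finset.disjoint_left.1 ht hj
    simp only [Set.Finite.mem_toFinset, Set.mem_ofPred_eq, not_not] at this
    exact this.le
  refine h.trans_lt ?_
  rw [mul_div_assoc', div_lt_iff₀ (by positivity)]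
  nlinarith

/-- A weakly unconditionally Cauchy series whose terms are bounded away from `0` yields a copy
of `c₀`. -/
theorem containsCopyOfC0_of_norm_ge [CompleteSpace F] {y : ℕ → F} {C ε : ℝ} (hε : 0 < ε)
    (hC : ∀ (s : Finset ℕ) (a : ℕ → 𝕜), (∀ j ∈ s, ‖a j‖ ≤ 1) → ‖∑ j ∈ s, a j • y j‖ ≤ C)
    (hy : ∀ j, ε ≤ ‖y j‖) : ContainsCopyOfC0 𝕜 F := by
  choose f hf hfy using fun j => exists_dual_vector'' 𝕜 (y j)
  obtain ⟨N, hN⟩ := exists_nat_ge (C / (ε / 2))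
  rw [div_le_iff₀ (by positivity)] at hN
  obtain ⟨φ, hφ, hoff⟩ := exists_injective_offDiag_sum_le (half_pos hε).le N
    (fun m k => ‖f m (y k)‖) (fun _ _ => norm_nonneg _)
    (fun m s => (sum_norm_apply_le hC (hf m) s).trans hN)
  have hCφ : ∀ (s : Finset ℕ) (a : ℕ → 𝕜), (∀ j ∈ s, ‖a j‖ ≤ 1) →
      ‖∑ j ∈ s, a j • y (φ j)‖ ≤ C := fun s a ha => by
    have h := hC (s.image φ) (fun j => a (Function.invFun φ j)) (by
      simpa [Function.leftInverse_invFun hφ _] using ha)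
    rw [Finset.sum_image hφ.injOn] at h
    simpa [Function.leftInverse_invFun hφ _] using h
  have hsum := summable_smul_of_zeroAtInfty hCφ
  have hub : ∀ x : ZeroAtInftyContinuousMap ℕ 𝕜, ‖∑' j, x j • y (φ j)‖ ≤ C * ‖x‖ := fun x => by
    rcases eq_or_ne x 0 with rfl | hx
    · simp
    · exact le_of_tendsto (hsum x).hasSum.norm <| Eventually.of_forall fun s =>
        norm_sum_smul_le_mul hCφ s x (norm_pos_iff.2 hx) fun j _ => norm_apply_le x j
  have hlb : ∀ (x : ZeroAtInftyContinuousMap ℕ 𝕜) (m : ℕ),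
      ε * ‖x m‖ ≤ ‖∑' j, x j • y (φ j)‖ + ε / 2 * ‖x‖ := fun x m => by
    rw [← sub_le_iff_le_add]
    refine ge_of_tendsto (hsum x).hasSum.norm ?_
    filter_upwards [eventually_ge_atTop {m}] with s hs
    have hms : m ∈ s := hs (Finset.mem_singleton_self m)
    have h1 := (f (φ m)).le_of_opNorm_le (hf (φ m)) (∑ j ∈ s, x j • y (φ j))
    rw [one_mul, map_sum, ← Finset.add_sum_erase s _ hms] at h1
    have h2 : ‖∑ j ∈ s.erase m, f (φ m) (x j • y (φ j))‖ ≤ ε / 2 * ‖x‖ := by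
      refine (norm_sum_le _ _).trans ?_
      calc ∑ j ∈ s.erase m, ‖f (φ m) (x j • y (φ j))‖
          ≤ ∑ j ∈ s.erase m, ‖f (φ m) (y (φ j))‖ * ‖x‖ := by
            refine Finset.sum_le_sum fun j _ => ?_
            rw [map_smul, norm_smul, mul_comm]
            exact mul_le_mul_of_nonneg_left (norm_apply_le x j) (norm_nonneg _)
        _ ≤ ε / 2 * ‖x‖ := by
            rw [← Finset.sum_mul]
            exact mul_le_mul_of_nonneg_right (hoff m _ (Finset.notMem_erase m s)) (norm_nonneg _)
    have h3 : ε * ‖x m‖ ≤ ‖f (φ m) (x m • y (φ m))‖ := by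
      rw [map_smul, norm_smul, hfy, RCLike.norm_ofReal, abs_norm, mul_comm]
      exact mul_le_mul_of_nonneg_left (hy _) (norm_nonneg _)
    have h4 := norm_sub_le_norm_add (f (φ m) (x m • y (φ m)))
      (∑ j ∈ s.erase m, f (φ m) (x j • y (φ j)))
    linarith
  let ι : ZeroAtInftyContinuousMap ℕ 𝕜 →ₗ[𝕜] F :=
    { toFun := fun x => ∑' j, x j • y (φ j)
      map_add' := fun x z => by
        simp only [ZeroAtInftyContinuousMap.add_apply, add_smul]
        exact (hsum x).tsum_add (hsum z)
      map_smul' := fun c x => by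
        simp only [ZeroAtInftyContinuousMap.smul_apply, smul_assoc, RingHom.id_apply]
        exact (hsum x).tsum_const_smul c }
  refine ⟨ι.mkContinuous C hub, ε / 2, max C (ε / 2), by positivity, le_max_right _ _,
    fun x => ⟨?_, (hub x).trans (mul_le_mul_of_nonneg_right (le_max_left _ _) (norm_nonneg _))⟩⟩
  change ε / 2 * ‖x‖ ≤ ‖∑' j, x j • y (φ j)‖
  have h : ‖x‖ ≤ (‖∑' j, x j • y (φ j)‖ + ε / 2 * ‖x‖) / ε :=
    norm_le_of_forall_apply_le (by positivity) fun m => by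
      rw [le_div_iff₀ hε, mul_comm]
      exact hlb x m
  rw [le_div_iff₀ hε] at h
  linarith

/-- **Bessaga–Pełczyński**: in a Banach space without a copy of `c₀`, every weakly unconditionally
Cauchy series converges unconditionally. -/
theorem summable_of_not_containsCopyOfC0 [CompleteSpace F] (hF : ¬ ContainsCopyOfC0 𝕜 F)
    {x : ℕ → F} {C : ℝ}
    (hC : ∀ (s : Finset ℕ) (a : ℕ → 𝕜), (∀ j ∈ s, ‖a j‖ ≤ 1) → ‖∑ j ∈ s, a j • x j‖ ≤ C) :
    Summable x := by
  classical
  by_contra hx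
  rw [summable_iff_vanishing_norm] at hx
  push Not at hx
  obtain ⟨ε, hε, hx⟩ := hx
  obtain ⟨t, ht, hdisj⟩ := exists_seq_of_forall_finset_exists'
    (fun t : Finset ℕ => ε ≤ ‖∑ j ∈ t, x j‖) Disjoint fun S _ => by
      obtain ⟨t, htS, ht⟩ := hx (S.sup id)
      exact ⟨t, ht, fun s hs => (htS.mono_right (Finset.le_sup (f := id) hs)).symm⟩
  refine hF (containsCopyOfC0_of_norm_ge hε (C := C) (fun s a ha => ?_) ht)
  have hex : ∀ j, ∃ c : 𝕜, ∀ m, j ∈ t m → c = a m := fun j => by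
    by_cases hj : ∃ m, j ∈ t m
    · obtain ⟨m, hm⟩ := hj
      refine ⟨a m, fun m' hm' => ?_⟩
      by_contra hne
      exact Finset.disjoint_left.1 (hdisj fun h : m = m' => hne (h ▸ rfl)) hm hm'
    · exact ⟨0, fun m hm => (hj ⟨m, hm⟩).elim⟩
  choose b hb using hex
  have h := hC (s.biUnion t) b fun j hj => by
    obtain ⟨m, hm, hj⟩ := Finset.mem_biUnion.1 hj
    exact (hb j m hj).symm ▸ ha m hm
  rw [Finset.sum_biUnion fun i _ j _ hij => hdisj hij] at h
  convert h using 2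
  refine Finset.sum_congr rfl fun m _ => ?_
  rw [Finset.smul_sum]
  exact Finset.sum_congr rfl fun j hj => by rw [hb j m hj]

end BoundedSeries

section Multilinear

variable {𝕜 E F : Type*} [RCLike 𝕜] [AddCommGroup E] [Module 𝕜 E]
  [NormedAddCommGroup F] [NormedSpace 𝕜 F]

/-- Averaging over signs shows that the mixed terms in the expansion of `T (u + d • v)` do not
decrease the norm for a suitable choice of `d`. -/
theorem exists_norm_add_smul_add_le {n : ℕ} (T : MultilinearMap 𝕜 (fun _ : Fin (n + 1) => E) F)
    (u v : Fin (n + 1) → E) {c : 𝕜} (hc : ‖c‖ ≤ 1) (y : F) :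
    ∃ d : Fin (n + 1) → 𝕜, (∀ i, ‖d i‖ ≤ 1) ∧
      ‖T u + c • T v + y‖ ≤ ‖T (fun i => u i + d i • v i) + y‖ := by
  induction n generalizing c y with
  | zero =>
    refine ⟨fun _ => c, fun _ => hc, le_of_eq ?_⟩
    have h (w : Fin 1 → E) : w = Function.update u 0 (w 0) := by
      ext i; fin_cases i; simp
    rw [h fun i => u i + c • v i, T.map_update_add, T.map_update_smul, ← h v,
      Function.update_eq_self]
  | succ n ih =>
    let S (s : 𝕜) := T.curryLeft (u 0 + s • v 0)
    have hS (s : 𝕜) (w : Fin (n + 1) → E) :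
        S s w = T.curryLeft (u 0) w + s • T.curryLeft (v 0) w := by
      simp [S]
    have key : ∃ s : 𝕜, ‖s‖ ≤ 1 ∧ ‖T u + c • T v + y‖ ≤
        ‖S s (Fin.tail u) + (s * c) • S s (Fin.tail v) + y‖ := by
      by_contra! hlt
      have h1 := hlt 1 (by simp)
      have h2 := hlt (-1) (by simp)
      have havg : (S 1 (Fin.tail u) + ((1 : 𝕜) * c) • S 1 (Fin.tail v) + y) +
          (S (-1) (Fin.tail u) + ((-1 : 𝕜) * c) • S (-1) (Fin.tail v) + y) =
          (2 : 𝕜) • (T u + c • T v + y) := by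
        have hu : T u = T.curryLeft (u 0) (Fin.tail u) := by simp
        have hv : T v = T.curryLeft (v 0) (Fin.tail v) := by simp
        rw [hu, hv]
        simp only [hS]
        module
      have h3 := congrArg norm havg
      rw [norm_smul, RCLike.norm_ofNat] at h3
      have h4 := norm_add_le (S 1 (Fin.tail u) + ((1 : 𝕜) * c) • S 1 (Fin.tail v) + y)
        (S (-1) (Fin.tail u) + ((-1 : 𝕜) * c) • S (-1) (Fin.tail v) + y)
      linarith
    obtain ⟨s, hs, hle⟩ := key
    obtain ⟨d, hd, hle'⟩ := ih (S s) (Fin.tail u) (Fin.tail v) (c := s * c)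
      (by rw [norm_mul]; exact mul_le_one₀ hs (norm_nonneg _) hc) y
    refine ⟨Fin.cons s d, Fin.cases hs hd, hle.trans (hle'.trans (le_of_eq ?_))⟩
    congr 2
    rw [MultilinearMap.curryLeft_apply]
    congr 1
    ext i
    cases i using Fin.cases <;> simp [Fin.tail]

theorem exists_norm_sum_smul_diagonal_le {n : ℕ}
    (T : MultilinearMap 𝕜 (fun _ : Fin (n + 1) => E) F) (v : Fin (n + 1) → ℕ → E)
    (s : Finset ℕ) {a : ℕ → 𝕜} (ha : ∀ j ∈ s, ‖a j‖ ≤ 1) (u : Fin (n + 1) → E) :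
    ∃ d : Fin (n + 1) → ℕ → 𝕜, (∀ i j, ‖d i j‖ ≤ 1) ∧
      ‖T u + ∑ j ∈ s, a j • T (fun i => v i j)‖ ≤
        ‖T (fun i => u i + ∑ j ∈ s, d i j • v i j)‖ := by
  classical
  induction s using Finset.induction_on generalizing u with
  | empty => exact ⟨0, by simp, by simp⟩
  | insert m s hm ih =>
    obtain ⟨d, hd, hle⟩ := exists_norm_add_smul_add_le T u (fun i => v i m)
      (ha m (Finset.mem_insert_self m s)) (∑ j ∈ s, a j • T (fun i => v i j))
    obtain ⟨e, he, hle'⟩ := ih (fun j hj => ha j (Finset.mem_insert_of_mem hj))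
      (fun i => u i + d i • v i m)
    refine ⟨fun i => Function.update (e i) m (d i), fun i j => ?_, ?_⟩
    · rcases eq_or_ne j m with rfl | hj
      · simpa using hd i
      · simpa [hj] using he i j
    · rw [Finset.sum_insert hm, ← add_assoc]
      refine hle.trans (hle'.trans (le_of_eq ?_))
      congr 2
      ext i
      rw [Finset.sum_insert hm, ← add_assoc]
      simp only [Function.update_self]
      congr 1
      refine Finset.sum_congr rfl fun j hj => ?_
      rw [Function.update_of_ne (ne_of_mem_of_not_mem hj hm)]

end Multilinear

theorem norm_sum_smul_block_le {𝕜 : Type*} [RCLike 𝕜] {k : ℕ → ℕ} (hk : StrictMono k)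
    {w : ℕ → ZeroAtInftyContinuousMap ℕ 𝕜}
    (hsupp : ∀ j l : ℕ, l ∉ Set.Ioc (k j) (k (j + 1)) → w j l = 0) (hw : ∀ j, ‖w j‖ ≤ 1)
    (s : Finset ℕ) {d : ℕ → 𝕜} (hd : ∀ j, ‖d j‖ ≤ 1) : ‖∑ j ∈ s, d j • w j‖ ≤ 1 := by
  refine norm_le_of_forall_apply_le zero_le_one fun l => ?_
  have happ : (∑ j ∈ s, d j • w j) l = ∑ j ∈ s, d j * w j l := by
    classical
    induction s using Finset.induction_on with
    | empty => simp
    | insert m s hm ih => simp [Finset.sum_insert hm, ih]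
  rw [happ]
  by_cases hl : ∃ m ∈ s, l ∈ Set.Ioc (k m) (k (m + 1))
  · obtain ⟨m, hm, hlm⟩ := hl
    rw [Finset.sum_eq_single_of_mem m hm, norm_mul]
    · exact mul_le_one₀ (hd m) (norm_nonneg _) ((norm_apply_le _ l).trans (hw m))
    · intro j _ hjm
      rw [hsupp j l fun hlj => ?_, mul_zero]
      exact Set.disjoint_left.1 (hk.monotone.pairwise_disjoint_on_Ioc_succ hjm) hlj hlm
  · push Not at hl
    rw [Finset.sum_eq_zero fun j hj => by rw [hsupp j l (hl j hj), mul_zero], norm_zero]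
    exact zero_le_one

theorem stmt3 (𝕜 : Type*) [RCLike 𝕜] (n : ℕ) (hn : 1 ≤ n)
    (F : Type*) [NormedAddCommGroup F] [NormedSpace 𝕜 F] [CompleteSpace F]
    (hF : ¬ ContainsCopyOfC0 𝕜 F)
    (T : ContinuousMultilinearMap 𝕜 (fun _ : Fin n => ZeroAtInftyContinuousMap ℕ 𝕜) F)
    (k : ℕ → ℕ) (hk : StrictMono k)
    (v : Fin n → ℕ → ZeroAtInftyContinuousMap ℕ 𝕜)
    (hsupp : ∀ (i : Fin n) (j l : ℕ), l ∉ Set.Ioc (k j) (k (j + 1)) → v i j l = 0)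
    (hnorm : ∀ (i : Fin n) (j : ℕ), ‖v i j‖ = 1) :
    (∀ σ : Equiv.Perm ℕ, ∃ a : F,
      Tendsto (fun N => ∑ j ∈ Finset.range N, T (fun i => v i (σ j))) atTop (𝓝 a)) ∧
    Tendsto (fun j => ‖T (fun i => v i j)‖) atTop (𝓝 0) := by
  obtain ⟨n, rfl⟩ := Nat.exists_eq_add_of_le' hn
  have hsum : Summable fun j => T (fun i => v i j) := by
    refine summable_of_not_containsCopyOfC0 hF (C := ‖T‖) fun s a ha => ?_
    obtain ⟨d, hd, hle⟩ := exists_norm_sum_smul_diagonal_le T.toMultilinearMap v s ha 0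
    rw [T.toMultilinearMap.map_zero, zero_add] at hle
    refine hle.trans ((T.le_opNorm _).trans (mul_le_of_le_one_right (norm_nonneg _) ?_))
    refine Finset.prod_le_one (fun _ _ => norm_nonneg _) fun i _ => ?_
    rw [Pi.zero_apply, zero_add]
    exact norm_sum_smul_block_le hk (hsupp i) (fun j => (hnorm i j).le) s (hd i)
  refine ⟨fun σ => ⟨_, ((σ.summable_iff).2 hsum).hasSum.tendsto_sum_nat⟩, ?_⟩
  simpa using hsum.tendsto_atTop_zero.norm

end GV
end
end

section
/- Let n ≥ 1 and let F be any Banach space. Every continuous n-linear map T : c₀ × ⋯ × c₀ → F which is weakly sequentially continuous is approximable, i.e., T lies in the operator-norm closure of the finite type n-linear maps. -/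
open Filter Topology

noncomputable section

namespace GV

/-- A continuous multilinear map is of *finite type* if it is a finite sum of maps of the form
`(x₁, …, xₙ) ↦ φ₁(x₁)⋯φₙ(xₙ) • f` with the `φᵢ` continuous linear functionals and `f ∈ F`. -/
def IsFiniteType {𝕜 : Type*} [RCLike 𝕜] {n : ℕ} {E : Fin n → Type*}
    [∀ i, NormedAddCommGroup (E i)] [∀ i, NormedSpace 𝕜 (E i)]
    {F : Type*} [NormedAddCommGroup F] [NormedSpace 𝕜 F]
    (T : ContinuousMultilinearMap 𝕜 E F) : Prop :=
  ∃ (r : ℕ) (φ : Fin r → ∀ i, E i →L[𝕜] 𝕜) (f : Fin r → F),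
    ∀ x : ∀ i, E i, T x = ∑ p : Fin r, (∏ i, φ p i (x i)) • f p

/-- A continuous multilinear map is *approximable* if it lies in the operator-norm closure of
the set of finite type continuous multilinear maps. -/
def Approximable {𝕜 : Type*} [RCLike 𝕜] {n : ℕ} {E : Fin n → Type*}
    [∀ i, NormedAddCommGroup (E i)] [∀ i, NormedSpace 𝕜 (E i)]
    {F : Type*} [NormedAddCommGroup F] [NormedSpace 𝕜 F]
    (T : ContinuousMultilinearMap 𝕜 E F) : Prop :=
  T ∈ closure {S : ContinuousMultilinearMap 𝕜 E F | IsFiniteType S}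

/-- A continuous multilinear map is *weakly sequentially continuous* if it sends coordinatewise
weakly convergent sequences to norm convergent sequences. -/
def WeaklySeqContinuous {𝕜 : Type*} [RCLike 𝕜] {n : ℕ} {E : Fin n → Type*}
    [∀ i, NormedAddCommGroup (E i)] [∀ i, NormedSpace 𝕜 (E i)]
    {F : Type*} [NormedAddCommGroup F] [NormedSpace 𝕜 F]
    (T : ContinuousMultilinearMap 𝕜 E F) : Prop :=
  ∀ (x : ℕ → ∀ i, E i) (x₀ : ∀ i, E i),
    (∀ i (φ : E i →L[𝕜] 𝕜), Tendsto (fun j => φ (x j i)) atTop (𝓝 (φ (x₀ i)))) →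
    Tendsto (fun j => T (x j)) atTop (𝓝 (T x₀))

open scoped ZeroAtInfty

section CZero

variable {𝕜 : Type*} [RCLike 𝕜]

theorem norm_apply_le_s4 (x : C₀(ℕ, 𝕜)) (i : ℕ) : ‖x i‖ ≤ ‖x‖ :=
  x.toBCF.norm_coe_le_norm i

theorem norm_le_of_forall_apply {x : C₀(ℕ, 𝕜)} {C : ℝ} (hC : 0 ≤ C) (h : ∀ i, ‖x i‖ ≤ C) :
    ‖x‖ ≤ C :=
  (BoundedContinuousFunction.norm_le (f := x.toBCF) hC).2 h

/-- The standard unit vectors of `c₀`. -/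
def unitVec (i : ℕ) : C₀(ℕ, 𝕜) where
  toFun := Pi.single i 1
  continuous_toFun := continuous_of_discreteTopology
  zero_at_infty' := by
    rw [cocompact_eq_cofinite]
    refine tendsto_const_nhds.congr' ?_
    filter_upwards [(Set.finite_singleton i).compl_mem_cofinite] with j hj
    exact (Pi.single_eq_of_ne (M := fun _ => 𝕜) hj 1).symm

theorem unitVec_apply (i j : ℕ) : (unitVec i : C₀(ℕ, 𝕜)) j = if j = i then 1 else 0 :=
  Pi.single_apply i (1 : 𝕜) j

/-- The coordinate functionals of `c₀`. -/
def coord (i : ℕ) : C₀(ℕ, 𝕜) →L[𝕜] 𝕜 :=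
  LinearMap.mkContinuous ⟨⟨fun x => x i, fun _ _ => rfl⟩, fun _ _ => rfl⟩ 1 fun x => by
    simpa using norm_apply_le_s4 x i

@[simp]
theorem coord_apply (i : ℕ) (x : C₀(ℕ, 𝕜)) : coord i x = x i := rfl

theorem sum_smul_unitVec_apply (N : ℕ) (c : ℕ → 𝕜) (j : ℕ) :
    (∑ i ∈ Finset.range N, c i • (unitVec i : C₀(ℕ, 𝕜))) j = if j < N then c j else 0 := by
  rw [← coord_apply, map_sum]
  simp [unitVec_apply]

theorem norm_sum_smul_unitVec_le (N : ℕ) {c : ℕ → 𝕜} {C : ℝ} (hC : 0 ≤ C)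
    (hc : ∀ i, ‖c i‖ ≤ C) : ‖∑ i ∈ Finset.range N, c i • (unitVec i : C₀(ℕ, 𝕜))‖ ≤ C := by
  refine norm_le_of_forall_apply hC fun j => ?_
  rw [sum_smul_unitVec_apply]
  split_ifs
  · exact hc j
  · simpa using hC

/-- The projection of `c₀` onto its first `N` coordinates. -/
def trunc (N : ℕ) : C₀(ℕ, 𝕜) →L[𝕜] C₀(ℕ, 𝕜) :=
  ∑ i ∈ Finset.range N, (coord i).smulRight (unitVec i)

theorem trunc_eq_sum (N : ℕ) (x : C₀(ℕ, 𝕜)) :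
    trunc N x = ∑ i ∈ Finset.range N, x i • unitVec i := by
  simp [trunc]

theorem trunc_apply (N : ℕ) (x : C₀(ℕ, 𝕜)) (j : ℕ) :
    trunc N x j = if j < N then x j else 0 := by
  rw [trunc_eq_sum, sum_smul_unitVec_apply N (fun i => x i)]

theorem norm_trunc_le (N : ℕ) (x : C₀(ℕ, 𝕜)) : ‖trunc N x‖ ≤ ‖x‖ := by
  rw [trunc_eq_sum]
  exact norm_sum_smul_unitVec_le N (norm_nonneg x) (norm_apply_le_s4 x)

theorem tendsto_trunc (x : C₀(ℕ, 𝕜)) : Tendsto (fun N => trunc N x) atTop (𝓝 x) := by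
  rw [Metric.tendsto_atTop]
  intro ε hε
  have hx := x.zero_at_infty'
  rw [cocompact_eq_cofinite, Nat.cofinite_eq_atTop, Metric.tendsto_atTop] at hx
  obtain ⟨N, hN⟩ := hx (ε / 2) (half_pos hε)
  refine ⟨N, fun M hM => ?_⟩
  rw [dist_eq_norm]
  refine (norm_le_of_forall_apply (half_pos hε).le fun j => ?_).trans_lt (half_lt_self hε)
  rw [ZeroAtInftyContinuousMap.sub_apply, trunc_apply]
  split_ifs with h
  · simpa using (half_pos hε).le
  · simpa using (hN j (by omega)).le

theorem summable_norm_apply_unitVec (φ : C₀(ℕ, 𝕜) →L[𝕜] 𝕜) :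
    Summable fun i => ‖φ (unitVec i)‖ := by
  choose c hc hφ using fun i => RCLike.exists_norm_eq_mul_self (φ (unitVec i))
  refine summable_of_sum_range_le (c := ‖φ‖) (fun _ => norm_nonneg _) fun N => ?_
  have h : φ (∑ i ∈ Finset.range N, c i • unitVec i)
      = ((∑ i ∈ Finset.range N, ‖φ (unitVec i)‖ : ℝ) : 𝕜) := by
    simp [hφ]
  calc ∑ i ∈ Finset.range N, ‖φ (unitVec i)‖
      = ‖φ (∑ i ∈ Finset.range N, c i • unitVec i)‖ := by
        rw [h, RCLike.norm_ofReal, abs_of_nonneg (Finset.sum_nonneg fun _ _ => norm_nonneg _)]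
    _ ≤ ‖φ‖ * 1 := φ.le_opNorm_of_le
        (norm_sum_smul_unitVec_le N zero_le_one fun i => (hc i).le)
    _ = ‖φ‖ := mul_one _

theorem norm_apply_sub_trunc_le (φ : C₀(ℕ, 𝕜) →L[𝕜] 𝕜) (N : ℕ) (x : C₀(ℕ, 𝕜)) :
    ‖φ (x - trunc N x)‖ ≤
      ‖x‖ * (∑' i, ‖φ (unitVec i)‖ - ∑ i ∈ Finset.range N, ‖φ (unitVec i)‖) := by
  have hlim : Tendsto (fun M => ‖φ (trunc M x - trunc N x)‖) atTop (𝓝 ‖φ (x - trunc N x)‖) :=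
    ((φ.continuous.tendsto _).comp ((tendsto_trunc x).sub_const _)).norm
  refine le_of_tendsto hlim ?_
  filter_upwards [eventually_ge_atTop N] with M hM
  have hsum : trunc M x - trunc N x = ∑ i ∈ Finset.Ico N M, x i • unitVec i := by
    rw [trunc_eq_sum, trunc_eq_sum, Finset.sum_Ico_eq_sub _ hM]
  calc ‖φ (trunc M x - trunc N x)‖
      ≤ ∑ i ∈ Finset.Ico N M, ‖x i‖ * ‖φ (unitVec i)‖ := by
        rw [hsum, map_sum]
        exact (norm_sum_le _ _).trans_eq (by simp)
    _ ≤ ∑ i ∈ Finset.Ico N M, ‖x‖ * ‖φ (unitVec i)‖ := by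
        gcongr with i
        exact norm_apply_le_s4 x i
    _ = ‖x‖ * (∑ i ∈ Finset.range M, ‖φ (unitVec i)‖
          - ∑ i ∈ Finset.range N, ‖φ (unitVec i)‖) := by
        rw [← Finset.mul_sum, Finset.sum_Ico_eq_sub _ hM]
    _ ≤ _ := by
        gcongr
        exact (summable_norm_apply_unitVec φ).sum_le_tsum _ fun _ _ => norm_nonneg _

/-- The tails of a bounded sequence in `c₀` form a weakly null sequence. -/
theorem tendsto_apply_sub_trunc {z : ℕ → C₀(ℕ, 𝕜)} {C : ℝ} (hz : ∀ N, ‖z N‖ ≤ C)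
    (φ : C₀(ℕ, 𝕜) →L[𝕜] 𝕜) :
    Tendsto (fun N => φ (z N - trunc N (z N))) atTop (𝓝 0) := by
  have hs := summable_norm_apply_unitVec φ
  have hlim : Tendsto (fun N => C * (∑' i, ‖φ (unitVec i)‖
      - ∑ i ∈ Finset.range N, ‖φ (unitVec i)‖)) atTop (𝓝 0) := by
    simpa using (hs.hasSum.tendsto_sum_nat.const_sub (∑' i, ‖φ (unitVec i)‖)).const_mul C
  refine squeeze_zero_norm (fun N => (norm_apply_sub_trunc_le φ N (z N)).trans ?_) hlim
  have := hs.sum_le_tsum (Finset.range N) fun _ _ => norm_nonneg _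
  exact mul_le_mul_of_nonneg_right (hz N) (sub_nonneg.2 this)

end CZero

section Multilinear

variable {𝕜 : Type*} [RCLike 𝕜] {n : ℕ} {F : Type*} [NormedAddCommGroup F] [NormedSpace 𝕜 F]
  {T : ContinuousMultilinearMap 𝕜 (fun _ : Fin n => C₀(ℕ, 𝕜)) F}

/-- If the coordinates in `B` stay bounded, the other ones converge weakly and at least one of
these is weakly null, then a weakly sequentially continuous `T` tends to zero. -/
theorem WeaklySeqContinuous.tendsto_zero (hT : WeaklySeqContinuous T) (B : Finset (Fin n)) :
    ∀ (x : ℕ → Fin n → C₀(ℕ, 𝕜)) (x₀ : Fin n → C₀(ℕ, 𝕜)),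
      (∀ i ∈ B, ∃ C, ∀ j, ‖x j i‖ ≤ C) →
      (∀ i ∉ B, ∀ φ : C₀(ℕ, 𝕜) →L[𝕜] 𝕜,
        Tendsto (fun j => φ (x j i)) atTop (𝓝 (φ (x₀ i)))) →
      (∃ i ∉ B, x₀ i = 0) → Tendsto (fun j => T (x j)) atTop (𝓝 0) := by
  induction B using Finset.induction_on with
  | empty =>
    rintro x x₀ - hx ⟨i, -, hi⟩
    have := hT x x₀ fun i φ => hx i (Finset.notMem_empty i) φ
    rwa [T.map_coord_zero i hi] at this
  | insert k B hk ih =>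
    rintro x x₀ hb hx ⟨l, hl, hl0⟩
    have hlk : l ≠ k := fun h => hl (h ▸ Finset.mem_insert_self k B)
    have hlB : l ∉ B := fun h => hl (Finset.mem_insert_of_mem h)
    -- Replacing the `k`-th coordinate by a weakly convergent sequence gives a null sequence.
    have key : ∀ (ms : ℕ → ℕ) (y : ℕ → C₀(ℕ, 𝕜)) (y₀ : C₀(ℕ, 𝕜)), Tendsto ms atTop atTop →
        (∀ φ : C₀(ℕ, 𝕜) →L[𝕜] 𝕜, Tendsto (fun j => φ (y j)) atTop (𝓝 (φ y₀))) →
        Tendsto (fun j => T (Function.update (x (ms j)) k (y j))) atTop (𝓝 0) := by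
      intro ms y y₀ hms hy
      refine ih _ (Function.update x₀ k y₀) (fun i hi => ?_) (fun i hi φ => ?_)
        ⟨l, hlB, by rwa [Function.update_of_ne hlk]⟩
      · obtain ⟨C, hC⟩ := hb i (Finset.mem_insert_of_mem hi)
        refine ⟨C, fun j => ?_⟩
        rw [Function.update_of_ne (ne_of_mem_of_not_mem hi hk)]
        exact hC _
      · by_cases hik : i = k
        · subst hik
          simpa using hy φ
        · simp only [Function.update_of_ne hik]
          exact (hx i (by simp [hik, hi]) φ).comp hms
    obtain ⟨C, hC⟩ := hb k (Finset.mem_insert_self k B)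
    have htrunc : ∀ N, Tendsto (fun j => T (Function.update (x j) k (trunc N (x j k))))
        atTop (𝓝 0) := by
      intro N
      have heq : ∀ j, T (Function.update (x j) k (trunc N (x j k)))
          = ∑ i ∈ Finset.range N, x j k i • T (Function.update (x j) k (unitVec i)) := by
        intro j
        rw [trunc_eq_sum, ← T.coe_coe, MultilinearMap.map_update_sum]
        simp
      simp only [heq]
      rw [← Finset.sum_const_zero (s := Finset.range N)]
      refine tendsto_finsetSum _ fun i _ => ?_
      refine IsBoundedUnder.smul_tendsto_zero ?_
        (key id (fun _ => unitVec i) (unitVec i) tendsto_id fun φ => tendsto_const_nhds)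
      exact isBoundedUnder_of ⟨C, fun j => (norm_apply_le_s4 _ i).trans (hC j)⟩
    refine tendsto_of_subseq_tendsto fun ns hns => ?_
    have hev : ∀ N : ℕ, ∃ j ≥ N,
        ‖T (Function.update (x (ns j)) k (trunc N (x (ns j) k)))‖ < 1 / ((N : ℝ) + 1) := by
      intro N
      have h := ((htrunc N).comp hns).norm
      rw [norm_zero] at h
      obtain ⟨j, hj, hjN⟩ := ((h.eventually_lt_const
        (Nat.one_div_pos_of_nat (n := N))).and (eventually_ge_atTop N)).exists
      exact ⟨j, hjN, hj⟩
    choose ms hms hsmall using hev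
    refine ⟨ms, ?_⟩
    have hmt : Tendsto (fun N => ns (ms N)) atTop atTop :=
      hns.comp (tendsto_atTop_mono hms tendsto_id)
    have hhead := squeeze_zero_norm (fun N => (hsmall N).le)
      tendsto_one_div_add_atTop_nhds_zero_nat
    have htail := key (fun N => ns (ms N))
      (fun N => x (ns (ms N)) k - trunc N (x (ns (ms N)) k)) 0 hmt fun φ => by
        rw [map_zero]
        exact tendsto_apply_sub_trunc (fun N => hC _) φ
    rw [← add_zero (0 : F)]
    refine (hhead.add htail).congr fun N => ?_
    rw [← T.map_update_add, add_sub_cancel, Function.update_eq_self]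

theorem WeaklySeqContinuous.tendsto_sub_trunc (hT : WeaklySeqContinuous T)
    (x : ℕ → Fin n → C₀(ℕ, 𝕜)) {C : ℝ} (hx : ∀ j i, ‖x j i‖ ≤ C) :
    Tendsto (fun N => T (x N) - T (fun i => trunc N (x N i))) atTop (𝓝 0) := by
  classical
  have heq : ∀ N, T (x N) - T (fun i => trunc N (x N i))
      = ∑ s ∈ Finset.univ.erase (Finset.univ : Finset (Fin n)),
        T (s.piecewise (fun i => trunc N (x N i)) (fun i => x N i - trunc N (x N i))) := by
    intro N
    have h := T.map_add_univ (fun i => trunc N (x N i)) (fun i => x N i - trunc N (x N i))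
    rw [← Finset.add_sum_erase _ _ (Finset.mem_univ Finset.univ), Finset.piecewise_univ] at h
    rw [sub_eq_iff_eq_add', ← h]
    congr 1
    ext1 i
    simp
  simp only [heq]
  rw [← Finset.sum_const_zero (s := Finset.univ.erase (Finset.univ : Finset (Fin n)))]
  refine tendsto_finsetSum _ fun s hs => ?_
  obtain ⟨k, hk⟩ : ∃ k, k ∉ s := by
    by_contra! h
    exact Finset.ne_of_mem_erase hs (Finset.eq_univ_iff_forall.2 h)
  refine hT.tendsto_zero s _ 0 (fun i hi => ⟨C, fun N => ?_⟩) (fun i hi φ => ?_) ⟨k, hk, rfl⟩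
  · rw [Finset.piecewise_eq_of_mem _ _ _ hi]
    exact (norm_trunc_le N _).trans (hx N i)
  · simp only [Finset.piecewise_eq_of_notMem _ _ _ hi, Pi.zero_apply, map_zero]
    exact tendsto_apply_sub_trunc (z := fun N => x N i) (fun N => hx N i) φ

theorem isFiniteType_comp_trunc (T : ContinuousMultilinearMap 𝕜 (fun _ : Fin n => C₀(ℕ, 𝕜)) F)
    (N : ℕ) : IsFiniteType (T.compContinuousLinearMap fun _ => trunc N) := by
  classical
  let e := Fintype.equivFin (Fin n → Fin N)
  refine ⟨_, fun p i => coord (e.symm p i), fun p => T fun i => unitVec (e.symm p i),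
    fun x => ?_⟩
  have h : ∀ i, trunc N (x i) = ∑ j : Fin N, x i j • unitVec (j : ℕ) := fun i => by
    rw [trunc_eq_sum, Finset.sum_range]
  rw [ContinuousMultilinearMap.compContinuousLinearMap_apply]
  simp only [h]
  rw [T.map_sum, ← e.symm.sum_comp]
  refine Finset.sum_congr rfl fun p _ => ?_
  rw [T.map_smul_univ]
  rfl

theorem exists_norm_le_one_of_lt_opNorm
    {S : ContinuousMultilinearMap 𝕜 (fun _ : Fin n => C₀(ℕ, 𝕜)) F} {r : ℝ} (hr : 0 ≤ r)
    (h : r < ‖S‖) : ∃ x : Fin n → C₀(ℕ, 𝕜), (∀ i, ‖x i‖ ≤ 1) ∧ r < ‖S x‖ := by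
  by_contra! hcon
  refine h.not_ge (S.opNorm_le_bound hr fun x => ?_)
  by_cases hx : ∃ i, x i = 0
  · obtain ⟨i, hi⟩ := hx
    rw [S.map_coord_zero i hi, norm_zero]
    positivity
  · push Not at hx
    have h1 := hcon (fun i => ((‖x i‖⁻¹ : ℝ) : 𝕜) • x i) fun i => by
      rw [norm_smul, RCLike.norm_ofReal, abs_of_nonneg (by positivity),
        inv_mul_cancel₀ (norm_ne_zero_iff.2 (hx i))]
    have hpos : 0 < ∏ i, ‖x i‖ := Finset.prod_pos fun i _ => norm_pos_iff.2 (hx i)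
    rw [S.map_smul_univ, norm_smul, norm_prod] at h1
    simp only [RCLike.norm_ofReal, abs_inv, abs_norm, Finset.prod_inv_distrib] at h1
    rwa [inv_mul_le_iff₀' hpos] at h1

end Multilinear

theorem stmt4 (𝕜 : Type*) [RCLike 𝕜] (n : ℕ) (hn : 1 ≤ n)
    (F : Type*) [NormedAddCommGroup F] [NormedSpace 𝕜 F] [CompleteSpace F]
    (T : ContinuousMultilinearMap 𝕜 (fun _ : Fin n => ZeroAtInftyContinuousMap ℕ 𝕜) F)
    (hT : WeaklySeqContinuous T) :
    Approximable T := by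
  refine (SeminormedAddCommGroup.mem_closure_iff
    (E := ContinuousMultilinearMap 𝕜 (fun _ : Fin n => C₀(ℕ, 𝕜)) F)).2 fun ε hε => ?_
  by_contra! hcon
  have hex : ∀ N : ℕ, ∃ x : Fin n → C₀(ℕ, 𝕜), (∀ i, ‖x i‖ ≤ 1) ∧
      ε / 2 < ‖(T - T.compContinuousLinearMap fun _ => trunc N) x‖ := fun N =>
    exists_norm_le_one_of_lt_opNorm (half_pos hε).le <| (half_lt_self hε).trans_le <|
      hcon _ (isFiniteType_comp_trunc T N)
  choose x hx hlt using hex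
  have hlim := (hT.tendsto_sub_trunc x hx).norm
  rw [norm_zero] at hlim
  obtain ⟨N, hN⟩ := (hlim.eventually_lt_const (half_pos hε)).exists
  exact (hlt N).not_gt hN

end GV
end
end
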